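/- For every natural number n, the total number of B_n type set partitions (the n-th Dowling number) equals the value at u = 1 of the polynomial A_n defined by A_0 = u, A_n = u·A_{n−1}' + u^2·A_{n−1}; equivalently, it equals Σ_{k=0}^{n} T(n,k), where T(n,k) is the number of B_n type partitions with exactly k block pairs. -/

import Mathlib

open Finset Polynomial

attribute [local instance] Classical.propDecidable

/-- The negation `−β` of a block `β ⊆ ℤ`. -/
def negBlock (β : Finset ℤ) : Finset ℤ := β.image (fun x => -x)

/-- `π` is a `Bₙ`-type set partition of `{−n, …, n}`: blocks come in pairs `β, −β`, and exactly
one block (the zero block) is symmetric. -/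
def IsBType {n : ℕ} (π : Finpartition (Finset.Icc (-(n : ℤ)) (n : ℤ))) : Prop :=
  (∀ β ∈ π.parts, negBlock β ∈ π.parts) ∧
  (π.parts.filter (fun β => negBlock β = β)).card = 1

/-- `T n k`: the number of `Bₙ`-type set partitions with exactly `k` block pairs
(i.e. with `2k+1` blocks in total). -/
noncomputable def Tb (n k : ℕ) : ℕ :=
  (univ.filter (fun π : Finpartition (Finset.Icc (-(n : ℤ)) (n : ℤ)) =>
    IsBType π ∧ π.parts.card = 2 * k + 1)).card

/-- Representative functions of `Bₙ`-type partitions. -/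
structure BRep (n : ℕ) (f : ℤ → ℤ) : Prop where
  odd : ∀ x, f (-x) = - f x
  out : ∀ x, (n : ℤ) < |x| → f x = 0
  le : ∀ x, |f x| ≤ |x|
  idem : ∀ x, f (f x) = f x

/-- Fixed points of `f`. -/
noncomputable def BFix (n : ℕ) (f : ℤ → ℤ) : Finset ℤ :=
  (Finset.Icc (-(n : ℤ)) (n : ℤ)).filter (fun x => f x = x)

/-- Extension of `g` by the value `v` at `n + 1`. -/
noncomputable def BUpd (n : ℕ) (g : ℤ → ℤ) (v : ℤ) : ℤ → ℤ := fun x =>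
  if x = (n : ℤ) + 1 then v else if x = -((n : ℤ) + 1) then -v else g x

/-- The finite set of all representative functions. -/
noncomputable def BF : ℕ → Finset (ℤ → ℤ)
  | 0 => {fun _ => 0}
  | (n + 1) => (BF n).biUnion fun g => (insert ((n : ℤ) + 1) (BFix n g)).image (BUpd n g)

lemma mem_BFix {n : ℕ} {f : ℤ → ℤ} {x : ℤ} :
    x ∈ BFix n f ↔ (-(n : ℤ) ≤ x ∧ x ≤ n) ∧ f x = x := by
  simp [BFix]

lemma BRep.zero {n : ℕ} {f : ℤ → ℤ} (h : BRep n f) : f 0 = 0 := by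
  have := h.odd 0
  simp at this
  omega

lemma BRep.upd {n : ℕ} {g : ℤ → ℤ} (h : BRep n g) {v : ℤ}
    (hv : v ∈ insert ((n : ℤ) + 1) (BFix n g)) : BRep (n + 1) (BUpd n g v) := by
  rw [Finset.mem_insert, mem_BFix] at hv
  have hle : ∀ x, |g x| ≤ n := by
    intro x
    by_cases hx : (n : ℤ) < |x|
    · rw [h.out x hx]; simp
    · exact (h.le x).trans (by omega)
  have hodd := h.odd
  refine ⟨?_, ?_, ?_, ?_⟩
  · intro x
    have := h.odd x
    unfold BUpd
    split_ifs <;> omega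
  · intro x hx
    have := h.out x
    push_cast at hx
    unfold BUpd
    split_ifs
    · subst x; rw [abs_of_nonneg (by omega)] at hx; omega
    · subst x; rw [abs_neg, abs_of_nonneg (by omega)] at hx; omega
    · exact this (by omega)
  · intro x
    have := h.le x
    unfold BUpd
    split_ifs
    · subst x; rw [abs_le, abs_of_nonneg (by omega)]; omega
    · subst x; rw [abs_le, abs_neg, abs_of_nonneg (by omega)]; omega
    · exact this
  · intro x
    have h1 := h.idem x
    have h2 := abs_le.1 (hle x)
    have h3 := h.odd v
    unfold BUpd
    split_ifs <;> omega

lemma BRep.exists_upd {n : ℕ} {f : ℤ → ℤ} (h : BRep (n + 1) f) :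
    ∃ g, BRep n g ∧ ∃ v ∈ insert ((n : ℤ) + 1) (BFix n g), BUpd n g v = f := by
  have hz := h.zero
  have hN := h.le ((n : ℤ) + 1)
  rw [abs_le, abs_of_nonneg (by omega : (0 : ℤ) ≤ (n : ℤ) + 1)] at hN
  have hid := h.idem ((n : ℤ) + 1)
  have hod := h.odd ((n : ℤ) + 1)
  refine ⟨BUpd n f 0, ⟨?_, ?_, ?_, ?_⟩, f ((n : ℤ) + 1), ?_, ?_⟩
  · intro x
    have := h.odd x
    unfold BUpd
    split_ifs <;> omega
  · intro x hx
    have h1 := h.out x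
    push_cast at h1
    unfold BUpd
    split_ifs
    · rfl
    · rfl
    · apply h1
      rw [lt_abs] at hx ⊢
      omega
  · intro x
    have := h.le x
    unfold BUpd
    split_ifs
    · simp
    · simp
    · exact this
  · intro x
    have h1 := h.idem x
    have h2 := h.le x
    have h3 := h.out x
    push_cast at h3
    have key : x ≠ (n : ℤ) + 1 → x ≠ -((n : ℤ) + 1) →
        f x ≠ (n : ℤ) + 1 ∧ f x ≠ -((n : ℤ) + 1) := by
      intro a b
      by_cases hx : (n : ℤ) + 1 < |x|
      · rw [h3 hx]; omega
      · rw [not_lt, abs_le] at hx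
        have : |x| ≤ n := by rw [abs_le]; omega
        have := abs_le.1 (h2.trans this)
        omega
    by_cases a : x = (n : ℤ) + 1
    · have : BUpd n f 0 x = 0 := by simp [BUpd, a]
      rw [this]
      unfold BUpd
      split_ifs <;> omega
    by_cases b : x = -((n : ℤ) + 1)
    · have : BUpd n f 0 x = 0 := by simp [BUpd, b]
      rw [this]
      unfold BUpd
      split_ifs <;> omega
    have : BUpd n f 0 x = f x := by unfold BUpd; rw [if_neg a, if_neg b]
    rw [this]
    have := key a b
    unfold BUpd
    rw [if_neg this.1, if_neg this.2, h1]
  · rw [Finset.mem_insert, mem_BFix]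
    by_cases hc : f ((n : ℤ) + 1) = (n : ℤ) + 1
    · exact Or.inl hc
    · right
      have hc' : f ((n : ℤ) + 1) ≠ -((n : ℤ) + 1) := by
        intro h6
        rw [h6] at hid
        omega
      refine ⟨by omega, ?_⟩
      unfold BUpd
      split_ifs <;> omega
  · funext x
    unfold BUpd
    split_ifs with a b
    · rw [a]
    · rw [b, hod]
    · rfl

lemma mem_BF {n : ℕ} {f : ℤ → ℤ} : f ∈ BF n ↔ BRep n f := by
  induction n generalizing f with
  | zero =>
    simp only [BF, Finset.mem_singleton]
    constructor
    · rintro rfl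
      exact ⟨by simp, by simp, by simp, by simp⟩
    · intro h
      funext x
      by_cases hx : x = 0
      · rw [hx, h.zero]
      · exact h.out x (by simpa using hx)
  | succ n ih =>
    simp only [BF, Finset.mem_biUnion, Finset.mem_image, ih]
    constructor
    · rintro ⟨g, hg, v, hv, rfl⟩
      exact hg.upd hv
    · intro h
      exact h.exists_upd

lemma BUpd_inj {n : ℕ} {g g' : ℤ → ℤ} (h : BRep n g) (h' : BRep n g') {v v' : ℤ}
    (e : BUpd n g v = BUpd n g' v') : g = g' ∧ v = v' := by
  constructor
  · funext x
    have := congrFun e x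
    have h1 := h.out x
    have h2 := h'.out x
    unfold BUpd at this
    by_cases hx : (n : ℤ) < |x|
    · rw [h1 hx, h2 hx]
    · rw [lt_abs] at hx
      rwa [if_neg (by omega), if_neg (by omega), if_neg (by omega), if_neg (by omega)] at this
  · have := congrFun e ((n : ℤ) + 1)
    simpa [BUpd] using this

lemma BFix_upd_old {n : ℕ} {g : ℤ → ℤ} {v : ℤ} (hv : v ∈ BFix n g) :
    BFix (n + 1) (BUpd n g v) = BFix n g := by
  rw [mem_BFix] at hv
  ext x
  rw [mem_BFix, mem_BFix]
  push_cast
  unfold BUpd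
  split_ifs <;> omega

lemma BFix_upd_new {n : ℕ} {g : ℤ → ℤ} :
    (BFix (n + 1) (BUpd n g ((n : ℤ) + 1))).card = (BFix n g).card + 2 := by
  have : BFix (n + 1) (BUpd n g ((n : ℤ) + 1)) =
      insert ((n : ℤ) + 1) (insert (-((n : ℤ) + 1)) (BFix n g)) := by
    ext x
    rw [mem_BFix, Finset.mem_insert, Finset.mem_insert, mem_BFix]
    push_cast
    unfold BUpd
    split_ifs <;> omega
  rw [this, Finset.card_insert_of_notMem, Finset.card_insert_of_notMem]
  · rw [mem_BFix]; omega
  · rw [Finset.mem_insert, mem_BFix]; omega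

lemma sum_BF_succ {M : Type*} [AddCommMonoid M] (n : ℕ) (w : ℕ → M) :
    ∑ f ∈ BF (n + 1), w (BFix (n + 1) f).card =
      ∑ g ∈ BF n, (w ((BFix n g).card + 2) + (BFix n g).card • w (BFix n g).card) := by
  rw [BF, Finset.sum_biUnion]
  · apply Finset.sum_congr rfl
    intro g hg
    rw [mem_BF] at hg
    rw [Finset.sum_image, Finset.sum_insert, BFix_upd_new]
    · congr 1
      rw [← Finset.sum_const]
      apply Finset.sum_congr rfl
      intro v hv
      rw [BFix_upd_old hv]
    · rw [mem_BFix]; omega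
    · intro v _ v' _ e
      exact (BUpd_inj hg hg e).2
  · intro g hg g' hg' hne
    rw [Finset.mem_coe, mem_BF] at hg hg'
    rw [Function.onFun, Finset.disjoint_left]
    intro f hf hf'
    rw [Finset.mem_image] at hf hf'
    obtain ⟨v, _, rfl⟩ := hf
    obtain ⟨v', _, e⟩ := hf'
    exact hne (BUpd_inj hg' hg e).1.symm

lemma BFix_zero {f : ℤ → ℤ} (h : BRep 0 f) : (BFix 0 f).card = 1 := by
  rw [Finset.card_eq_one]
  refine ⟨0, ?_⟩
  ext x
  rw [mem_BFix, Finset.mem_singleton]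
  have := h.zero
  push_cast
  constructor
  · omega
  · rintro rfl; simpa using this

lemma BFix_card_odd (n : ℕ) : ∀ f, BRep n f → ∃ k < n + 1, (BFix n f).card = 2 * k + 1 := by
  induction n with
  | zero => intro f h; exact ⟨0, by omega, BFix_zero h⟩
  | succ n ih =>
    intro f h
    obtain ⟨g, hg, v, hv, rfl⟩ := h.exists_upd
    obtain ⟨k, hk, e⟩ := ih g hg
    rw [Finset.mem_insert] at hv
    rcases hv with rfl | hv
    · exact ⟨k + 1, by omega, by rw [BFix_upd_new]; omega⟩
    · exact ⟨k, by omega, by rw [BFix_upd_old hv]; omega⟩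

lemma sum_BF_eq (A : ℕ → Polynomial ℚ)
    (hA0 : A 0 = X)
    (hA : ∀ m, A (m + 1) = X * derivative (A m) + X ^ 2 * A m)
    (n : ℕ) : A n = ∑ f ∈ BF n, (X : Polynomial ℚ) ^ (BFix n f).card := by
  induction n with
  | zero =>
    have : BRep 0 (fun _ => 0) := mem_BF.1 (by simp [BF])
    simp [BF, BFix_zero this, hA0]
  | succ n ih =>
    rw [hA, ih, sum_BF_succ n (fun m => (X : Polynomial ℚ) ^ m), derivative_sum,
      Finset.mul_sum, Finset.mul_sum, ← Finset.sum_add_distrib]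
    apply Finset.sum_congr rfl
    intro g hg
    obtain ⟨k, -, e⟩ := BFix_card_odd n g (mem_BF.1 hg)
    rw [e]
    have h2 : (C 2 : Polynomial ℚ) = 2 := rfl
    simp [h2]
    ring

/-- The fiber of `f` through `x`. -/
noncomputable def BFib (n : ℕ) (f : ℤ → ℤ) (x : ℤ) : Finset ℤ :=
  (Finset.Icc (-(n : ℤ)) (n : ℤ)).filter (fun y => f y = f x)

lemma mem_BFib {n : ℕ} {f : ℤ → ℤ} {x y : ℤ} :
    y ∈ BFib n f x ↔ (-(n : ℤ) ≤ y ∧ y ≤ n) ∧ f y = f x := by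
  simp [BFib]

/-- The partition by fibers of `f`. -/
noncomputable def BPart (n : ℕ) (f : ℤ → ℤ) : Finpartition (Finset.Icc (-(n : ℤ)) (n : ℤ)) :=
  Finpartition.ofExistsUnique ((Finset.Icc (-(n : ℤ)) (n : ℤ)).image (BFib n f))
    (by
      intro p hp
      rw [Finset.mem_image] at hp
      obtain ⟨x, -, rfl⟩ := hp
      exact Finset.filter_subset _ _)
    (by
      intro a ha
      refine ⟨BFib n f a, ⟨Finset.mem_image_of_mem _ ha, ?_⟩, ?_⟩
      · rw [mem_BFib, ← Finset.mem_Icc]; exact ⟨ha, rfl⟩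
      · rintro p ⟨hp, hap⟩
        rw [Finset.mem_image] at hp
        obtain ⟨x, -, rfl⟩ := hp
        rw [mem_BFib] at hap
        ext y
        rw [mem_BFib, mem_BFib, hap.2])
    (by
      intro hp
      rw [Finset.mem_image] at hp
      obtain ⟨x, hx, e⟩ := hp
      have : x ∈ BFib n f x := by
        rw [mem_BFib, ← Finset.mem_Icc]; exact ⟨hx, rfl⟩
      rw [e] at this
      simp at this)

lemma mem_BPart {n : ℕ} {f : ℤ → ℤ} {p : Finset ℤ} :
    p ∈ (BPart n f).parts ↔ ∃ x, (-(n : ℤ) ≤ x ∧ x ≤ n) ∧ BFib n f x = p := by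
  simp [BPart, Finpartition.ofExistsUnique]

lemma mem_negBlock {β : Finset ℤ} {x : ℤ} : x ∈ negBlock β ↔ -x ∈ β := by
  unfold negBlock
  rw [Finset.mem_image]
  constructor
  · rintro ⟨y, hy, rfl⟩; simpa using hy
  · intro h; exact ⟨-x, h, by simp⟩

lemma BRep.neg_fib {n : ℕ} {f : ℤ → ℤ} (h : BRep n f) (x : ℤ) :
    negBlock (BFib n f x) = BFib n f (-x) := by
  ext y
  rw [mem_negBlock, mem_BFib, mem_BFib, h.odd, h.odd]
  omega

lemma BRep.bounds {n : ℕ} {f : ℤ → ℤ} (h : BRep n f) (x : ℤ) :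
    -(n : ℤ) ≤ f x ∧ f x ≤ n := by
  rw [← abs_le]
  by_cases hx : (n : ℤ) < |x|
  · rw [h.out x hx]; simp
  · exact (h.le x).trans (by omega)

lemma BRep.isBType {n : ℕ} {f : ℤ → ℤ} (h : BRep n f) : IsBType (BPart n f) := by
  refine ⟨?_, ?_⟩
  · intro β hβ
    rw [mem_BPart] at hβ ⊢
    obtain ⟨x, hx, rfl⟩ := hβ
    exact ⟨-x, by omega, (h.neg_fib x).symm⟩
  · rw [Finset.card_eq_one]
    refine ⟨BFib n f 0, ?_⟩
    ext β
    rw [Finset.mem_filter, Finset.mem_singleton, mem_BPart]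
    constructor
    · rintro ⟨⟨x, hx, rfl⟩, e⟩
      rw [h.neg_fib] at e
      have : x ∈ BFib n f (-x) := by rw [e, mem_BFib]; exact ⟨hx, rfl⟩
      rw [mem_BFib, h.odd] at this
      ext y
      rw [mem_BFib, mem_BFib, h.zero]
      omega
    · rintro rfl
      refine ⟨⟨0, by omega, rfl⟩, ?_⟩
      rw [h.neg_fib, neg_zero]

lemma BRep.card_parts {n : ℕ} {f : ℤ → ℤ} (h : BRep n f) :
    (BPart n f).parts.card = (BFix n f).card := by
  have : (BPart n f).parts = (BFix n f).image (BFib n f) := by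
    ext p
    rw [mem_BPart, Finset.mem_image]
    constructor
    · rintro ⟨x, hx, rfl⟩
      refine ⟨f x, mem_BFix.2 ⟨h.bounds x, h.idem x⟩, ?_⟩
      ext y
      rw [mem_BFib, mem_BFib, h.idem]
    · rintro ⟨x, hx, rfl⟩
      exact ⟨x, (mem_BFix.1 hx).1, rfl⟩
  rw [this, Finset.card_image_of_injOn]
  intro x hx y hy e
  rw [Finset.mem_coe, mem_BFix] at hx hy
  have : x ∈ BFib n f y := by
    rw [← e, mem_BFib]; exact ⟨hx.1, rfl⟩
  rw [mem_BFib] at this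
  omega

lemma BPart_rel {n : ℕ} {f g : ℤ → ℤ} (e : BPart n f = BPart n g) {x y : ℤ}
    (hx : -(n : ℤ) ≤ x ∧ x ≤ n) (hy : -(n : ℤ) ≤ y ∧ y ≤ n) (hxy : f x = f y) : g x = g y := by
  have h1 : BFib n f x ∈ (BPart n g).parts := by
    rw [← e, mem_BPart]; exact ⟨x, hx, rfl⟩
  rw [mem_BPart] at h1
  obtain ⟨z, hz, e'⟩ := h1
  have hx' : x ∈ BFib n g z := by rw [e', mem_BFib]; exact ⟨hx, rfl⟩
  have hy' : y ∈ BFib n g z := by rw [e', mem_BFib]; exact ⟨hy, hxy.symm⟩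
  rw [mem_BFib] at hx' hy'
  rw [hx'.2, hy'.2]

lemma BPart_inj {n : ℕ} {f g : ℤ → ℤ} (hf : BRep n f) (hg : BRep n g)
    (e : BPart n f = BPart n g) : f = g := by
  funext x
  by_cases hx : (n : ℤ) < |x|
  · rw [hf.out x hx, hg.out x hx]
  rw [not_lt, abs_le] at hx
  have h1 : g (f x) = g x := BPart_rel e (hf.bounds x) hx (hf.idem x)
  have h2 : f (g x) = f x := BPart_rel e.symm (hg.bounds x) hx (hg.idem x)
  have h3 := hg.le (f x)
  have h4 := hf.le (g x)
  rw [h1] at h3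
  rw [h2] at h4
  have h5 : |f x| = |g x| := le_antisymm h4 h3
  rcases abs_eq_abs.1 h5 with h6 | h6
  · exact h6
  · rw [h6, hg.odd, hg.idem] at h1
    omega

lemma BPart_surj {n : ℕ} (π : Finpartition (Finset.Icc (-(n : ℤ)) (n : ℤ))) (hπ : IsBType π) :
    ∃ f, BRep n f ∧ BPart n f = π := by
  obtain ⟨hneg, hone⟩ := hπ
  have huniq : ∀ β ∈ π.parts, ∀ γ ∈ π.parts, ∀ x, x ∈ β → x ∈ γ → β = γ :=
    fun β hβ γ hγ x hx hx' => π.eq_of_mem_parts hβ hγ hx hx'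
  have h0mem : (0 : ℤ) ∈ Finset.Icc (-(n : ℤ)) (n : ℤ) := by simp
  have hsymm : ∀ β ∈ π.parts, negBlock β = β → (0 : ℤ) ∈ β := by
    intro β hβ hs
    obtain ⟨ζ, hζ, h0⟩ := π.exists_mem h0mem
    have hζs : negBlock ζ = ζ :=
      huniq _ (hneg ζ hζ) _ hζ 0 (by rw [mem_negBlock]; simpa using h0) h0
    rw [Finset.card_eq_one] at hone
    obtain ⟨δ, hδ⟩ := hone
    have h1 : β ∈ ({δ} : Finset (Finset ℤ)) := by
      rw [← hδ, Finset.mem_filter]; exact ⟨hβ, hs⟩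
    have h2 : ζ ∈ ({δ} : Finset (Finset ℤ)) := by
      rw [← hδ, Finset.mem_filter]; exact ⟨hζ, hζs⟩
    rw [Finset.mem_singleton] at h1 h2
    rw [h1, ← h2]; exact h0
  have hm : ∀ β : Finset ℤ, ∃ m, β.Nonempty → m ∈ β ∧ ∀ y ∈ β, |m| ≤ |y| := by
    intro β
    by_cases hβ : β.Nonempty
    · obtain ⟨m, hm, hm'⟩ := β.exists_min_image (fun y => |y|) hβ
      exact ⟨m, fun _ => ⟨hm, hm'⟩⟩
    · exact ⟨0, fun h => absurd h hβ⟩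
  choose m hm using hm
  have hmem : ∀ β ∈ π.parts, m β ∈ β := fun β hβ => (hm β (π.nonempty_of_mem_parts hβ)).1
  have hmin : ∀ β ∈ π.parts, ∀ y ∈ β, |m β| ≤ |y| :=
    fun β hβ => (hm β (π.nonempty_of_mem_parts hβ)).2
  have hmneg : ∀ β ∈ π.parts, m (negBlock β) = - m β := by
    intro β hβ
    have hβ' := hneg β hβ
    have a1 := hmem _ hβ'
    have a2 := hmem _ hβ
    have a3 := hmin _ hβ (-m (negBlock β)) (mem_negBlock.1 a1)
    have a4 := hmin _ hβ' (-m β) (by rw [mem_negBlock]; simpa using a2)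
    rw [abs_neg] at a3 a4
    rcases abs_eq_abs.1 (le_antisymm a4 a3) with h6 | h6
    · rw [h6] at a1
      have hs := huniq _ hβ' _ hβ _ a1 a2
      have h0 := hmin _ hβ 0 (hsymm β hβ hs)
      have : m β = 0 := by simpa using h0
      omega
    · exact h6
  have hmpart : ∀ β ∈ π.parts, ∀ x ∈ β, π.part x = β := fun β hβ x hx =>
    π.part_eq_of_mem hβ hx
  let f : ℤ → ℤ := fun x => if x ∈ Finset.Icc (-(n : ℤ)) (n : ℤ) then m (π.part x) else 0
  have hfβ : ∀ β ∈ π.parts, ∀ x ∈ β, f x = m β := by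
    intro β hβ x hx
    have : x ∈ Finset.Icc (-(n : ℤ)) (n : ℤ) := π.le hβ hx
    simp only [f]
    rw [if_pos this, hmpart β hβ x hx]
  have hfout : ∀ x, x ∉ Finset.Icc (-(n : ℤ)) (n : ℤ) → f x = 0 := by
    intro x hx
    simp only [f]
    rw [if_neg hx]
  have hf0 : f 0 = 0 := by
    obtain ⟨ζ, hζ, h0⟩ := π.exists_mem h0mem
    rw [hfβ ζ hζ 0 h0]
    simpa using hmin ζ hζ 0 h0
  have hrep : BRep n f := by
    refine ⟨?_, ?_, ?_, ?_⟩
    · intro x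
      by_cases hx : x ∈ Finset.Icc (-(n : ℤ)) (n : ℤ)
      · obtain ⟨β, hβ, hxβ⟩ := π.exists_mem hx
        rw [hfβ β hβ x hxβ, hfβ _ (hneg β hβ) (-x) (by rw [mem_negBlock]; simpa using hxβ),
          hmneg β hβ]
      · rw [hfout x hx, hfout (-x), neg_zero]
        rw [Finset.mem_Icc] at hx ⊢
        omega
    · intro x hx
      apply hfout
      rw [Finset.mem_Icc, ← abs_le]
      omega
    · intro x
      by_cases hx : x ∈ Finset.Icc (-(n : ℤ)) (n : ℤ)
      · obtain ⟨β, hβ, hxβ⟩ := π.exists_mem hx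
        rw [hfβ β hβ x hxβ]
        exact hmin β hβ x hxβ
      · rw [hfout x hx]; simp
    · intro x
      by_cases hx : x ∈ Finset.Icc (-(n : ℤ)) (n : ℤ)
      · obtain ⟨β, hβ, hxβ⟩ := π.exists_mem hx
        rw [hfβ β hβ x hxβ, hfβ β hβ _ (hmem β hβ)]
      · rw [hfout x hx, hf0]
  have hfib : ∀ β ∈ π.parts, ∀ x ∈ β, BFib n f x = β := by
    intro β hβ x hx
    ext y
    rw [mem_BFib, ← Finset.mem_Icc, hfβ β hβ x hx]
    constructor
    · rintro ⟨hy, e⟩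
      obtain ⟨γ, hγ, hyγ⟩ := π.exists_mem hy
      rw [hfβ γ hγ y hyγ] at e
      have h1 := hmem γ hγ
      rw [e] at h1
      rw [huniq β hβ γ hγ _ (hmem β hβ) h1]
      exact hyγ
    · intro hy
      exact ⟨π.le hβ hy, hfβ β hβ y hy⟩
  refine ⟨f, hrep, ?_⟩
  apply Finpartition.ext
  ext p
  rw [mem_BPart]
  constructor
  · rintro ⟨x, hx, rfl⟩
    obtain ⟨β, hβ, hxβ⟩ := π.exists_mem (Finset.mem_Icc.2 hx)
    rw [hfib β hβ x hxβ]; exact hβ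
  · intro hp
    obtain ⟨x, hx⟩ := π.nonempty_of_mem_parts hp
    exact ⟨x, Finset.mem_Icc.1 (π.le hp hx), hfib p hp x hx⟩

/-- The `n`-th Dowling number (the total number of `Bₙ`-type set partitions) equals the value at
`u = 1` of the polynomial `A n` (where `A 0 = u`, `A n = u·(A (n−1))' + u²·(A (n−1))`), and
equals `Σ_{k=0}^{n} T(n,k)`. -/
theorem dowling_number_eq_eval_one
    (A : ℕ → Polynomial ℚ)
    (hA0 : A 0 = X)
    (hA : ∀ m, A (m + 1) = X * derivative (A m) + X ^ 2 * A m)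
    (n : ℕ) :
    (((univ.filter (fun π : Finpartition (Finset.Icc (-(n : ℤ)) (n : ℤ)) =>
        IsBType π)).card : ℚ) = (A n).eval 1) ∧
    (univ.filter (fun π : Finpartition (Finset.Icc (-(n : ℤ)) (n : ℤ)) =>
        IsBType π)).card = ∑ k ∈ range (n + 1), Tb n k := by
  constructor
  · rw [sum_BF_eq A hA0 hA n, eval_finsetSum]
    simp only [eval_pow, eval_X, one_pow, Finset.sum_const, nsmul_eq_mul, mul_one]
    norm_cast
    symm
    apply Finset.card_bij (fun f _ => BPart n f)
    · intro f hf
      rw [Finset.mem_filter]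
      exact ⟨Finset.mem_univ _, (mem_BF.1 hf).isBType⟩
    · intro f hf g hg e
      exact BPart_inj (mem_BF.1 hf) (mem_BF.1 hg) e
    · intro π hπ
      obtain ⟨f, hf, e⟩ := BPart_surj π (Finset.mem_filter.1 hπ).2
      exact ⟨f, mem_BF.2 hf, e⟩
  · have hk : ∀ π : Finpartition (Finset.Icc (-(n : ℤ)) (n : ℤ)), IsBType π →
        ∃ k < n + 1, π.parts.card = 2 * k + 1 := by
      intro π hπ
      obtain ⟨f, hf, rfl⟩ := BPart_surj π hπ
      rw [hf.card_parts]
      exact BFix_card_odd n f hf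
    rw [Finset.card_eq_sum_card_fiberwise (f := fun π => (π.parts.card - 1) / 2)
      (t := range (n + 1))]
    · apply Finset.sum_congr rfl
      intro k _
      unfold Tb
      rw [Finset.filter_filter]
      congr 1
      apply Finset.filter_congr
      intro π _
      constructor
      · rintro ⟨h1, h2⟩
        obtain ⟨j, -, e⟩ := hk π h1
        exact ⟨h1, by omega⟩
      · rintro ⟨h1, h2⟩
        exact ⟨h1, by omega⟩
    · intro π hπ
      obtain ⟨j, hj, e⟩ := hk π (Finset.mem_filter.1 (Finset.mem_coe.1 hπ)).2
      rw [Finset.mem_coe, Finset.mem_range]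
      show (π.parts.card - 1) / 2 < n + 1
      omega
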